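/- For every ε with 0 < ε < 1 there exist a constant c > 0 and an integer n₀ such that for every n ≥ n₀ there exists a transitive PFA with n states and exactly 2 symbols, together with a subset S of its state set, such that S is carefully synchronized by some word and the shortest word carefully synchronizing S has length at least c · (3 − ε)^{n/3}. -/

import Mathlib

/-- Action of a PFA (partial) transition function on a subset of states along a word:
one step maps `S` to `{δ q a : q ∈ S}` if `δ q a` is defined for all `q ∈ S`,
and to `∅` otherwise. -/
def pfaRun {n m : ℕ} (δ : Fin n → Fin m → Option (Fin n)) :
    Finset (Fin n) → List (Fin m) → Finset (Fin n)
  | S, [] => S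
  | S, a :: w =>
      pfaRun δ
        (if ∀ q ∈ S, (δ q a).isSome then S.image (fun q => (δ q a).getD q) else ∅) w

/-- A word `w` carefully synchronizes the subset `S` in the PFA `δ`. -/
def pfaSync {n m : ℕ} (δ : Fin n → Fin m → Option (Fin n)) (S : Finset (Fin n))
    (w : List (Fin m)) : Prop :=
  (pfaRun δ S w).card = 1

/-- A PFA is transitive if every state can be sent to every other state by some word. -/
def pfaTransitive {n m : ℕ} (δ : Fin n → Fin m → Option (Fin n)) : Prop :=
  ∀ q q' : Fin n, ∃ w, pfaRun δ {q} w = {q'}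

section Run

variable {Q : Type*} {m : ℕ}

/-- Run of a single state along a word, undefined as soon as one transition is. -/
def evalWord (f : Q → Fin m → Option Q) : Q → List (Fin m) → Option Q
  | q, [] => some q
  | q, a :: w => (f q a).bind fun r => evalWord f r w

theorem evalWord_append (f : Q → Fin m → Option Q) (q : Q) (u w : List (Fin m)) :
    evalWord f q (u ++ w) = (evalWord f q u).bind fun r => evalWord f r w := by
  induction u generalizing q with
  | nil => rfl
  | cons a u ih =>
    simp only [List.cons_append, evalWord, Option.bind_assoc]
    exact congrArg _ (funext fun r => ih r)

theorem evalWord_append_of_eq {f : Q → Fin m → Option Q} {q r : Q} {u : List (Fin m)}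
    (h : evalWord f q u = some r) (w : List (Fin m)) :
    evalWord f q (u ++ w) = evalWord f r w := by
  rw [evalWord_append, h, Option.bind_some]

theorem exists_evalWord_of_reflTransGen {f : Q → Fin m → Option Q} {q r : Q}
    (h : Relation.ReflTransGen (fun s t => ∃ a, f s a = some t) q r) :
    ∃ w, evalWord f q w = some r := by
  induction h using Relation.ReflTransGen.head_induction_on with
  | refl => exact ⟨[], rfl⟩
  | head hst _ ih =>
    obtain ⟨a, ha⟩ := hst
    obtain ⟨w, hw⟩ := ih
    exact ⟨a :: w, by simp [evalWord, ha, hw]⟩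

theorem evalWord_conj {Q' : Type*} (f : Q → Fin m → Option Q) (e : Q ≃ Q') (q : Q)
    (w : List (Fin m)) :
    evalWord (fun s a => (f (e.symm s) a).map e) (e q) w = (evalWord f q w).map e := by
  induction w generalizing q with
  | nil => rfl
  | cons a w ih =>
    simp only [evalWord, Equiv.symm_apply_apply]
    cases f q a with
    | none => rfl
    | some r => simpa using ih r

variable {n : ℕ} (δ : Fin n → Fin m → Option (Fin n))

theorem pfaRun_empty (w : List (Fin m)) : pfaRun δ ∅ w = ∅ := by
  induction w with
  | nil => rfl
  | cons a w ih => simpa [pfaRun] using ih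

variable {δ}

theorem exists_evalWord_of_pfaRun_nonempty {S : Finset (Fin n)} {w : List (Fin m)}
    (h : (pfaRun δ S w).Nonempty) {q : Fin n} (hq : q ∈ S) :
    ∃ r ∈ pfaRun δ S w, evalWord δ q w = some r := by
  induction w generalizing S q with
  | nil => exact ⟨q, hq, rfl⟩
  | cons a w ih =>
    simp only [pfaRun] at h ⊢
    split_ifs at h ⊢ with hS
    · obtain ⟨s, hs⟩ := Option.isSome_iff_exists.1 (hS q hq)
      have hmem : s ∈ S.image fun q => (δ q a).getD q :=
        Finset.mem_image.2 ⟨q, hq, by simp [hs]⟩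
      obtain ⟨r, hr, hw⟩ := ih h hmem
      exact ⟨r, hr, by simp [evalWord, hs, hw]⟩
    · simp [pfaRun_empty] at h

theorem pfaRun_eq_singleton {S : Finset (Fin n)} {w : List (Fin m)} {r : Fin n}
    (hS : S.Nonempty) (h : ∀ q ∈ S, evalWord δ q w = some r) : pfaRun δ S w = {r} := by
  induction w generalizing S with
  | nil =>
    refine Finset.eq_singleton_iff_nonempty_unique_mem.2 ⟨hS, fun q hq => ?_⟩
    simpa [evalWord] using h q hq
  | cons a w ih =>
    have hdef : ∀ q ∈ S, ∃ s, δ q a = some s ∧ evalWord δ s w = some r := fun q hq => by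
      simpa [evalWord, Option.bind_eq_some_iff] using h q hq
    have hsome : ∀ q ∈ S, (δ q a).isSome := fun q hq => by
      obtain ⟨s, hs, -⟩ := hdef q hq
      simp [hs]
    simp only [pfaRun, if_pos hsome]
    refine ih (hS.image _) fun s hs => ?_
    obtain ⟨q, hq, rfl⟩ := Finset.mem_image.1 hs
    obtain ⟨s, hs, hw⟩ := hdef q hq
    simpa [hs] using hw

theorem pfaSync_iff {S : Finset (Fin n)} (hS : S.Nonempty) {w : List (Fin m)} :
    pfaSync δ S w ↔ ∃ r, ∀ q ∈ S, evalWord δ q w = some r := by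
  constructor
  · intro h
    obtain ⟨r, hr⟩ := Finset.card_eq_one.1 h
    refine ⟨r, fun q hq => ?_⟩
    obtain ⟨s, hs, hw⟩ := exists_evalWord_of_pfaRun_nonempty (hr ▸ Finset.singleton_nonempty r) hq
    rw [hr, Finset.mem_singleton] at hs
    exact hs ▸ hw
  · rintro ⟨r, hr⟩
    rw [pfaSync, pfaRun_eq_singleton hS hr, Finset.card_singleton]

end Run

/-! ### A ternary counter stored in a rotating ring -/

namespace TernaryCounter

/-- The states outside of the ring and of the padding chain.
`dᵢ` hold the digit at the head (`d₂` and `d₃` the digit two), `zᵢ` is the control without carry,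
`oᵢ` the control with carry, and `eᵢ` the merging loop. -/
inductive Aux
  | d₀ | d₁ | d₂ | d₃
  | z₀ | z₁ | z₂ | z₃
  | o₀ | o₁ | o₂ | o₃
  | e₀ | e₁ | e₂ | e₃ | e₄
  deriving DecidableEq

instance : Fintype Aux where
  elems :=
    {.d₀, .d₁, .d₂, .d₃, .z₀, .z₁, .z₂, .z₃, .o₀, .o₁, .o₂, .o₃, .e₀, .e₁, .e₂, .e₃, .e₄}
  complete s := by cases s <;> decide

/-- The states of the automaton: a ring of `K + 1` cells with three states each, the auxiliary
states, and a chain of `p + 1` padding states. -/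
inductive State (K p : ℕ)
  | ring (i : Fin (K + 1)) (v : Fin 3)
  | aux (s : Aux)
  | pad (i : Fin (p + 1))

open Aux State

variable {K p : ℕ}

/-- The states as a disjoint union. -/
def stateEquiv (K p : ℕ) : State K p ≃ (Fin (K + 1) × Fin 3) ⊕ Aux ⊕ Fin (p + 1) where
  toFun
    | ring i v => .inl (i, v)
    | aux s => .inr (.inl s)
    | pad i => .inr (.inr i)
  invFun
    | .inl (i, v) => ring i v
    | .inr (.inl s) => aux s
    | .inr (.inr i) => pad i
  left_inv q := by cases q <;> rfl
  right_inv q := by rcases q with _ | _ | _ <;> rfl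

instance : Fintype (State K p) := Fintype.ofEquiv _ (stateEquiv K p).symm

theorem card_state : Fintype.card (State K p) = 3 * K + 21 + p := by
  have hAux : Fintype.card Aux = 17 := rfl
  rw [Fintype.card_congr (stateEquiv K p)]
  simp only [Fintype.card_sum, Fintype.card_prod, Fintype.card_fin, hAux]
  ring

/-- The state in which the processing of a digit begins. -/
def enter : Fin 3 → Aux
  | 0 => d₀
  | 1 => d₁
  | 2 => d₂

/-- The rotating letter. -/
def rotate : State K p → Option (State K p)
  | ring i v => some (ring (i - 1) v)
  | pad i => some (if i = 0 then aux z₀ else pad (i - 1))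
  | aux d₀ => some (ring (-1) 1)
  | aux d₁ => some (ring (-1) 2)
  | aux d₃ => some (ring (-1) 0)
  | aux z₀ => some (aux z₀)
  | aux z₃ => some (aux o₀)
  | aux o₁ => some (aux z₀)
  | aux o₂ => some (aux o₀)
  | aux o₃ => some (aux e₀)
  | aux e₀ => some (pad (Fin.last p))
  | aux e₁ => some (ring 0 0)
  | aux e₄ => some (aux e₀)
  | aux _ => none

/-- The processing letter, which only affects the cell `0` of the ring. -/
def operate : State K p → Option (State K p)
  | ring i v => some (if i = 0 then aux (enter v) else ring i v)
  | pad _ => none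
  | aux d₀ => some (aux e₂)
  | aux d₂ => some (aux d₃)
  | aux z₀ => some (aux z₁)
  | aux z₁ => some (aux z₂)
  | aux z₂ => some (aux z₃)
  | aux o₀ => some (aux o₁)
  | aux o₁ => some (aux o₂)
  | aux o₂ => some (aux o₃)
  | aux e₀ => some (aux e₁)
  | aux e₁ => some (aux e₂)
  | aux e₂ => some (aux e₃)
  | aux e₃ => some (aux e₄)
  | aux _ => none

/-- The transition function: `0` rotates, `1` processes. -/
def step (q : State K p) (a : Fin 2) : Option (State K p) :=
  if a = 0 then rotate q else operate q

theorem evalWord_zero_cons (q : State K p) (w : List (Fin 2)) :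
    evalWord step q (0 :: w) = (rotate q).bind fun r => evalWord step r w := rfl

theorem evalWord_one_cons (q : State K p) (w : List (Fin 2)) :
    evalWord step q (1 :: w) = (operate q).bind fun r => evalWord step r w := rfl

theorem evalWord_ring_of_ne_zero {i : Fin (K + 1)} (hi : i ≠ 0) (v : Fin 3) (m : ℕ)
    (w : List (Fin 2)) :
    evalWord step (ring i v : State K p) (List.replicate m 1 ++ w) =
      evalWord step (ring i v) w := by
  induction m with
  | zero => rfl
  | succ m ih => simpa [List.replicate_succ, evalWord_one_cons, operate, hi] using ih

/-- A digit away from the head is only rotated. -/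
theorem evalWord_ring_sub {i h : Fin (K + 1)} (hi : i ≠ h) (v : Fin 3) (m : ℕ)
    (w : List (Fin 2)) :
    evalWord step (ring (i - h) v : State K p) (List.replicate m 1 ++ 0 :: w) =
      evalWord step (ring (i - (h + 1)) v) w := by
  rw [evalWord_ring_of_ne_zero (sub_ne_zero.2 hi), evalWord_zero_cons, rotate, Option.bind_some,
    sub_sub]

/-! ### Configurations -/

/-- The control state for a given carry. -/
def control (c : Bool) : Aux := bif c then o₀ else z₀

/-- The word `w` leads the control and all digits to `r`; the head is at index `h`, and there is no
digit with index `Fin.last K`. -/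
def Merges (w : List (Fin 2)) (r : State K p) (x : Fin K → Fin 3) (h : Fin (K + 1)) (c : Bool) :
    Prop :=
  evalWord step (aux (control c)) w = some r ∧
    ∀ i : Fin K, evalWord step (ring (i.castSucc - h) (x i)) w = some r

/-- The number stored by the digits, lowest digit first. -/
def value (x : Fin K → Fin 3) : ℕ := ∑ i, (x i : ℕ) * 3 ^ (i : ℕ)

theorem value_lt (x : Fin K → Fin 3) : value x < 3 ^ K := by
  induction K with
  | zero => simp [value]
  | succ K ih =>
    have h := ih fun i => x i.castSucc
    have hx : (x (Fin.last K) : ℕ) ≤ 2 := by omega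
    have := Nat.mul_le_mul_right (3 ^ K) hx
    simp only [value, Fin.sum_univ_castSucc, Fin.val_castSucc, Fin.val_last, pow_succ] at h ⊢
    omega

theorem eq_zero_of_value_eq_zero {x : Fin K → Fin 3} (h : value x = 0) : x = 0 := by
  funext i
  have := (Finset.sum_eq_zero_iff.1 h) i (Finset.mem_univ i)
  exact Fin.ext ((Nat.mul_eq_zero.1 this).resolve_right (by positivity))

theorem value_update (x : Fin K → Fin 3) (i : Fin K) (v : Fin 3) :
    value (Function.update x i v) + x i * 3 ^ (i : ℕ) = value x + v * 3 ^ (i : ℕ) := by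
  have hrest : ∑ j ∈ Finset.univ.erase i, (Function.update x i v j : ℕ) * 3 ^ (j : ℕ) =
      ∑ j ∈ Finset.univ.erase i, (x j : ℕ) * 3 ^ (j : ℕ) :=
    Finset.sum_congr rfl fun j hj => by rw [Function.update_of_ne (Finset.ne_of_mem_erase hj)]
  rw [value, value, ← Finset.add_sum_erase _ _ (Finset.mem_univ i), hrest,
    ← Finset.add_sum_erase _ (fun j => (x j : ℕ) * 3 ^ (j : ℕ)) (Finset.mem_univ i)]
  simp only [Function.update_self]
  ring

/-- The stored number plus the pending carry at the head. -/
def potential (x : Fin K → Fin 3) (h : Fin (K + 1)) (c : Bool) : ℕ :=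
  value x + bif c then 3 ^ (h : ℕ) else 0

/-- At the empty cell all digits are only rotated. -/
theorem evalWord_last (i : Fin K) (v : Fin 3) (m : ℕ) (w : List (Fin 2)) :
    evalWord step (ring (i.castSucc - Fin.last K) v : State K p) (List.replicate m 1 ++ 0 :: w) =
      evalWord step (ring (i.castSucc - 0) v) w := by
  rw [evalWord_ring_sub (Fin.castSucc_ne_last i), Fin.last_add_one]

/-- A digit at the head is replaced, the others are rotated. -/
theorem evalWord_castSucc {x : Fin K → Fin 3} {j : Fin K} {v : Fin 3} {m : ℕ}
    (hv : evalWord step (ring 0 (x j) : State K p) (List.replicate m 1 ++ [0]) =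
      some (ring (-1) v)) (i : Fin K) (w : List (Fin 2)) :
    evalWord step (ring (i.castSucc - j.castSucc) (x i) : State K p)
        (List.replicate m 1 ++ 0 :: w) =
      evalWord step (ring (i.castSucc - (j.castSucc + 1)) (Function.update x j v i)) w := by
  rcases eq_or_ne i j with rfl | hij
  · rw [Function.update_self, sub_self, List.append_cons, evalWord_append_of_eq hv, ← sub_sub,
      sub_self, zero_sub]
  · rw [Function.update_of_ne hij,
      evalWord_ring_sub ((Fin.castSucc_injective K).ne hij)]

theorem merges_last_iff {w : List (Fin 2)} {r : State K p} {x : Fin K → Fin 3} {c c' : Bool}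
    {m : ℕ} (hc : evalWord step (aux (control c) : State K p) (List.replicate m 1 ++ [0]) =
      some (aux (control c'))) :
    Merges (List.replicate m 1 ++ 0 :: w) r x (Fin.last K) c ↔ Merges w r x 0 c' := by
  refine and_congr ?_ (forall_congr' fun i => by rw [evalWord_last])
  rw [List.append_cons, evalWord_append_of_eq hc]

theorem merges_castSucc_iff {w : List (Fin 2)} {r : State K p} {x : Fin K → Fin 3} {j : Fin K}
    {c c' : Bool} {v : Fin 3} {m : ℕ}
    (hc : evalWord step (aux (control c) : State K p) (List.replicate m 1 ++ [0]) =
      some (aux (control c')))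
    (hv : evalWord step (ring 0 (x j) : State K p) (List.replicate m 1 ++ [0]) =
      some (ring (-1) v)) :
    Merges (List.replicate m 1 ++ 0 :: w) r x j.castSucc c ↔
      Merges w r (Function.update x j v) (j.castSucc + 1) c' := by
  refine and_congr ?_ (forall_congr' fun i => by rw [evalWord_castSucc hv])
  rw [List.append_cons, evalWord_append_of_eq hc]

/-! ### The lower bound -/

theorem exists_eq_replicate_one (w : List (Fin 2)) :
    ∃ m, w = List.replicate m 1 ∨ ∃ w', w = List.replicate m 1 ++ 0 :: w' := by
  induction w with
  | nil => exact ⟨0, .inl rfl⟩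
  | cons a w ih =>
    obtain rfl | rfl : a = 0 ∨ a = 1 := by omega
    · exact ⟨0, .inr ⟨w, rfl⟩⟩
    · obtain ⟨m, rfl | ⟨w', rfl⟩⟩ := ih
      · exact ⟨m + 1, .inl rfl⟩
      · exact ⟨m + 1, .inr ⟨w', rfl⟩⟩

theorem evalWord_control_replicate {c : Bool} {m : ℕ} {w : List (Fin 2)} (hm : 3 < m) :
    evalWord step (aux (control c) : State K p) (List.replicate m 1 ++ w) = none := by
  obtain ⟨m, rfl⟩ := Nat.exists_eq_add_of_lt hm
  rw [show 3 + m + 1 = 4 + m by omega, List.replicate_add, List.append_assoc, evalWord_append]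
  cases c <;> rfl

theorem not_merges_replicate (hK : 0 < K) {m : ℕ} (hm : m ≤ 3) {r : State K p}
    {x : Fin K → Fin 3} {h : Fin (K + 1)} {c : Bool} : ¬ Merges (List.replicate m 1) r x h c := by
  rintro ⟨hc, hx⟩
  have hx₀ := hx ⟨0, hK⟩
  rw [← hc] at hx₀
  generalize x ⟨0, hK⟩ = v at hx₀
  generalize Fin.castSucc _ - h = i at hx₀
  by_cases hi : i = 0
  · subst hi
    interval_cases m <;> fin_cases v <;> cases c <;>
      simp [evalWord, step, operate, control, enter] at hx₀
  · have := evalWord_ring_of_ne_zero (p := p) hi v m []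
    rw [List.append_nil, hx₀] at this
    interval_cases m <;> cases c <;>
      simp [evalWord, step, operate, control] at this

/-- Passing on the carry keeps the potential. -/
theorem potential_update {x : Fin K → Fin 3} {j : Fin K} {v : Fin 3} {c c' : Bool}
    (h : (v : ℕ) + (bif c' then 3 else 0) = x j + (bif c then 1 else 0)) :
    potential (Function.update x j v) (j.castSucc + 1) c' = potential x j.castSucc c := by
  have hval := value_update x j v
  have hmul := congrArg (· * 3 ^ (j : ℕ)) h
  simp only [potential, Fin.coeSucc_eq_succ, Fin.val_succ, Fin.val_castSucc, pow_succ]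
  cases c <;> cases c' <;>
    simp only [cond_false, cond_true, add_mul, one_mul, add_zero] at hmul ⊢ <;> omega

/-- Processing a digit at the head keeps the potential. -/
theorem exists_merges_of_castSucc {m : ℕ} (hm : m ≤ 3) {w : List (Fin 2)} {r : State K p}
    {x : Fin K → Fin 3} {j : Fin K} {c : Bool}
    (hw : Merges (List.replicate m 1 ++ 0 :: w) r x j.castSucc c) :
    ∃ x' c', Merges w r x' (j.castSucc + 1) c' ∧
      potential x' (j.castSucc + 1) c' = potential x j.castSucc c := by
  have key : ∀ v c', evalWord step (aux (control c) : State K p) (List.replicate m 1 ++ [0]) =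
      some (aux (control c')) →
      evalWord step (ring 0 (x j) : State K p) (List.replicate m 1 ++ [0]) =
        some (ring (-1) v) →
      (v : ℕ) + (bif c' then 3 else 0) = x j + (bif c then 1 else 0) →
      ∃ x' c', Merges w r x' (j.castSucc + 1) c' ∧
        potential x' (j.castSucc + 1) c' = potential x j.castSucc c := fun v c' hc hv hsum =>
    ⟨_, c', (merges_castSucc_iff hc hv).1 hw, potential_update hsum⟩
  have hc := hw.1
  have hj := hw.2 j
  rw [sub_self] at hj
  generalize x j = v at hj key
  interval_cases m <;> fin_cases v <;> cases c <;>
    simp [evalWord, step, operate, rotate, control, enter] at hj hc key ⊢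
  all_goals exact key

theorem pow_le_of_merges (hK : 0 < K) {w : List (Fin 2)} {r : State K p} {x : Fin K → Fin 3}
    {h : Fin (K + 1)} {c : Bool} (hw : Merges w r x h c) :
    3 ^ K ≤ potential x h c + w.length := by
  induction hn : w.length using Nat.strong_induction_on generalizing w x h c with
  | _ n ih =>
  subst hn
  obtain ⟨m, hm⟩ := exists_eq_replicate_one w
  have hm3 : m ≤ 3 := by
    by_contra! hlt
    have hnone : evalWord step (aux (control c) : State K p) w = none := by
      obtain rfl | ⟨w', rfl⟩ := hm
      · simpa using evalWord_control_replicate (K := K) (p := p) (c := c) (w := []) hlt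
      · exact evalWord_control_replicate hlt
    simp [hw.1] at hnone
  obtain rfl | ⟨w', rfl⟩ := hm
  · exact absurd hw (not_merges_replicate hK hm3)
  · have hlen : (List.replicate m (1 : Fin 2) ++ 0 :: w').length = m + w'.length + 1 := by
      simp [add_assoc]
    rw [hlen] at ih ⊢
    induction h using Fin.lastCases with
    | cast j =>
      obtain ⟨x', c', hw', hpot⟩ := exists_merges_of_castSucc hm3 hw
      have := ih _ (by omega) hw' rfl
      omega
    | last =>
      cases c with
      | true => simp only [potential, cond_true, Fin.val_last]; omega
      | false =>
        have key : ∀ c', evalWord step (aux (control false) : State K p)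
            (List.replicate m 1 ++ [0]) = some (aux (control c')) →
            3 ^ K ≤ potential x (Fin.last K) false + (m + w'.length + 1) := fun c' hc => by
          have := ih _ (by omega) ((merges_last_iff hc).1 hw) rfl
          cases c' <;> simp [potential] at this ⊢ <;> omega
        have hc := hw.1
        interval_cases m
        · exact key false rfl
        · simp [evalWord, step, operate, rotate, control] at hc
        · simp [evalWord, step, operate, rotate, control] at hc
        · exact key true rfl

/-! ### Existence of a merging word -/

theorem exists_merges_castSucc (x : Fin K → Fin 3) (j : Fin K) (c : Bool) :
    ∃ m x' c', (∀ (w : List (Fin 2)) (r : State K p), Merges w r x' (j.castSucc + 1) c' →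
      Merges (List.replicate m 1 ++ 0 :: w) r x j.castSucc c) ∧
      potential x' (j.castSucc + 1) c' = potential x j.castSucc c := by
  have key : ∀ m v c', evalWord step (aux (control c) : State K p) (List.replicate m 1 ++ [0]) =
      some (aux (control c')) →
      evalWord step (ring 0 (x j) : State K p) (List.replicate m 1 ++ [0]) =
        some (ring (-1) v) →
      (v : ℕ) + (bif c' then 3 else 0) = x j + (bif c then 1 else 0) →
      ∃ m x' c', (∀ (w : List (Fin 2)) (r : State K p), Merges w r x' (j.castSucc + 1) c' →
        Merges (List.replicate m 1 ++ 0 :: w) r x j.castSucc c) ∧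
        potential x' (j.castSucc + 1) c' = potential x j.castSucc c :=
    fun m v c' hc hv hsum =>
      ⟨m, _, c', fun w r => (merges_castSucc_iff hc hv).2, potential_update hsum⟩
  cases c with
  | false => exact key 0 (x j) false rfl (by simp [evalWord, step, rotate]) rfl
  | true =>
    generalize x j = v at key
    fin_cases v
    · exact key 1 1 false rfl rfl rfl
    · exact key 1 2 false rfl rfl rfl
    · exact key 2 0 true rfl rfl rfl

/-- In the merging loop, the zero digits that have not yet passed the head are collected. -/
theorem exists_collect (h : Fin (K + 1)) :
    ∃ w, evalWord step (aux e₀ : State K p) w = some (aux e₀) ∧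
      ∀ i : Fin K, h ≤ i.castSucc →
        evalWord step (ring (i.castSucc - h) 0 : State K p) w = some (aux e₀) := by
  induction h using Fin.reverseInduction with
  | last => exact ⟨[], rfl, fun i hi => absurd hi (Fin.castSucc_lt_last i).not_ge⟩
  | cast j ih =>
    obtain ⟨w, he, hw⟩ := ih
    refine ⟨List.replicate 4 1 ++ 0 :: w, he, fun i hi => ?_⟩
    rcases eq_or_ne i j with rfl | hij
    · rw [sub_self]
      exact he
    · rw [evalWord_ring_sub ((Fin.castSucc_injective K).ne hij), Fin.coeSucc_eq_succ]
      exact hw i (Fin.succ_le_castSucc_iff.2 (lt_of_le_of_ne hi hij.symm))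

theorem exists_merges (x : Fin K → Fin 3) (h : Fin (K + 1)) (c : Bool)
    (hpot : potential x h c ≤ 3 ^ K) :
    ∃ w, Merges w (aux e₀ : State K p) x h c := by
  obtain ⟨N, hN⟩ := Nat.exists_eq_add_of_le hpot
  clear hpot
  induction N using Nat.strong_induction_on generalizing x h c with
  | _ N ihN =>
  induction h using Fin.reverseInduction generalizing x c with
  | cast j ih =>
    obtain ⟨m, x', c', hw, hpot⟩ := exists_merges_castSucc (p := p) x j c
    rw [Fin.coeSucc_eq_succ] at hw hpot
    obtain ⟨w, hw'⟩ := ih x' c' (by rw [hpot, hN])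
    exact ⟨_, hw w _ hw'⟩
  | last =>
    cases c with
    | false =>
      have hlt := value_lt x
      simp only [potential, cond_false, add_zero] at hN
      obtain ⟨w, hw⟩ := ihN (N - 1) (by omega) x 0 true (by simp [potential]; omega)
      exact ⟨_, (merges_last_iff (m := 3) rfl).2 hw⟩
    | true =>
      simp only [potential, cond_true, Fin.val_last] at hN
      obtain rfl := eq_zero_of_value_eq_zero (x := x) (by omega)
      obtain ⟨w, he, hw⟩ := exists_collect (K := K) (p := p) 0
      refine ⟨List.replicate 3 1 ++ 0 :: w, ?_, fun i => ?_⟩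
      · rwa [List.append_cons, evalWord_append_of_eq (r := aux e₀) rfl]
      · rw [evalWord_last]
        exact hw i (Fin.zero_le _)

/-! ### Transitivity -/

/-- Reachability in the automaton. -/
abbrev Reach (q r : State K p) : Prop :=
  Relation.ReflTransGen (fun s t => ∃ a, step s a = some t) q r

theorem reach_of_rotate {q r : State K p} (h : rotate q = some r) : Reach q r :=
  .single ⟨0, h⟩

theorem reach_of_operate {q r : State K p} (h : operate q = some r) : Reach q r :=
  .single ⟨1, h⟩

theorem reach_ring_sub_nat (i : Fin (K + 1)) (v : Fin 3) (m : ℕ) :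
    Reach (ring i v : State K p) (ring (i - Fin.ofNat (K + 1) m) v) := by
  induction m with
  | zero =>
    have : i - Fin.ofNat (K + 1) 0 = i := by simp
    rw [this]
  | succ m ih =>
    refine ih.trans (reach_of_rotate ?_)
    have : Fin.ofNat (K + 1) (m + 1) = Fin.ofNat (K + 1) m + 1 := by
      ext; simp [Fin.val_add]
    rw [rotate, this, sub_sub]

theorem reach_ring (i j : Fin (K + 1)) (v : Fin 3) :
    Reach (ring i v : State K p) (ring j v) := by
  have h := reach_ring_sub_nat (p := p) i v (i - j : Fin (K + 1))
  rwa [Fin.ofNat_val_eq_self, sub_sub_cancel] at h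

theorem reach_enter (v : Fin 3) : Reach (ring 0 v : State K p) (aux (enter v)) :=
  reach_of_operate rfl

theorem reach_ring_zero_one (i j : Fin (K + 1)) : Reach (ring i 0 : State K p) (ring j 1) :=
  (reach_ring i 0 0).trans <| (reach_enter 0).trans <|
    (reach_of_rotate (by rfl : _ = some (ring (-1) 1))).trans (reach_ring _ j 1)

theorem reach_ring_one_two (i j : Fin (K + 1)) : Reach (ring i 1 : State K p) (ring j 2) :=
  (reach_ring i 0 1).trans <| (reach_enter 1).trans <|
    (reach_of_rotate (by rfl : _ = some (ring (-1) 2))).trans (reach_ring _ j 2)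

theorem reach_ring_two_zero (i j : Fin (K + 1)) : Reach (ring i 2 : State K p) (ring j 0) :=
  (reach_ring i 0 2).trans <| (reach_enter 2).trans <|
    (reach_of_operate (by rfl : _ = some (aux d₃))).trans <|
    (reach_of_rotate (by rfl : _ = some (ring (-1) 0))).trans (reach_ring _ j 0)

theorem reach_pad (i : Fin (p + 1)) : Reach (pad (Fin.last p) : State K p) (pad i) := by
  induction i using Fin.reverseInduction with
  | last => exact .refl
  | cast i ih =>
    refine ih.trans (reach_of_rotate ?_)
    rw [rotate, if_neg (Fin.succ_ne_zero i), ← Fin.coeSucc_eq_succ, add_sub_cancel_right]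

theorem reach_z₀_of_pad (i : Fin (p + 1)) : Reach (pad i : State K p) (aux z₀) := by
  induction i using Fin.induction with
  | zero => exact reach_of_rotate rfl
  | succ i ih =>
    refine Relation.ReflTransGen.trans (reach_of_rotate ?_) ih
    rw [rotate, if_neg (Fin.succ_ne_zero i), ← Fin.coeSucc_eq_succ, add_sub_cancel_right]

theorem reach_e₀_of_aux : ∀ s : Aux, Reach (aux s : State K p) (aux e₀) := by
  have he₄ : Reach (aux e₄ : State K p) (aux e₀) := reach_of_rotate rfl
  have he₃ := (reach_of_operate (K := K) (p := p) (q := aux e₃) rfl).trans he₄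
  have he₂ := (reach_of_operate (K := K) (p := p) (q := aux e₂) rfl).trans he₃
  have he₁ := (reach_of_operate (K := K) (p := p) (q := aux e₁) rfl).trans he₂
  have ho₃ : Reach (aux o₃ : State K p) (aux e₀) := reach_of_rotate rfl
  have ho₂ := (reach_of_operate (K := K) (p := p) (q := aux o₂) rfl).trans ho₃
  have ho₁ := (reach_of_operate (K := K) (p := p) (q := aux o₁) rfl).trans ho₂
  have ho₀ := (reach_of_operate (K := K) (p := p) (q := aux o₀) rfl).trans ho₁
  have hz₃ := (reach_of_rotate (K := K) (p := p) (q := aux z₃) rfl).trans ho₀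
  have hz₂ := (reach_of_operate (K := K) (p := p) (q := aux z₂) rfl).trans hz₃
  have hz₁ := (reach_of_operate (K := K) (p := p) (q := aux z₁) rfl).trans hz₂
  have hz₀ := (reach_of_operate (K := K) (p := p) (q := aux z₀) rfl).trans hz₁
  have hd₀ := (reach_of_operate (K := K) (p := p) (q := aux d₀) rfl).trans he₂
  have hr := ((reach_ring (-1) 0 0).trans (reach_enter 0)).trans hd₀
  have hd₃ := (reach_of_rotate (K := K) (p := p) (q := aux d₃) rfl).trans hr
  have hd₂ := (reach_of_operate (K := K) (p := p) (q := aux d₂) rfl).trans hd₃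
  have hd₁ := (reach_of_rotate (K := K) (p := p) (q := aux d₁) rfl).trans
    ((reach_ring_two_zero (-1) (-1)).trans hr)
  rintro (_ | _ | _ | _ | _ | _ | _ | _ | _ | _ | _ | _ | _ | _ | _ | _ | _)
  all_goals first | exact .refl | assumption

theorem reach_e₀ : ∀ q : State K p, Reach q (aux e₀)
  | aux s => reach_e₀_of_aux s
  | pad i => (reach_z₀_of_pad i).trans (reach_e₀_of_aux z₀)
  | ring i v => ((reach_ring i 0 v).trans (reach_enter v)).trans (reach_e₀_of_aux _)

theorem reach_ring_of_e₀ (i : Fin (K + 1)) (v : Fin 3) :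
    Reach (aux e₀ : State K p) (ring i v) := by
  have h₁ : Reach (aux e₀ : State K p) (aux e₁) := reach_of_operate rfl
  have h₀ : Reach (aux e₀ : State K p) (ring 0 0) := h₁.trans (reach_of_rotate rfl)
  fin_cases v
  · exact h₀.trans (reach_ring 0 i 0)
  · exact h₀.trans (reach_ring_zero_one 0 i)
  · exact h₀.trans ((reach_ring_zero_one 0 0).trans (reach_ring_one_two 0 i))

theorem reach_pad_of_e₀ (i : Fin (p + 1)) : Reach (aux e₀ : State K p) (pad i) :=
  (reach_of_rotate rfl).trans (reach_pad i)

theorem reach_aux_of_e₀ : ∀ s : Aux, Reach (aux e₀ : State K p) (aux s) := by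
  have he₁ : Reach (aux e₀ : State K p) (aux e₁) := reach_of_operate rfl
  have he₂ := he₁.trans (reach_of_operate (r := aux e₂) rfl)
  have he₃ := he₂.trans (reach_of_operate (r := aux e₃) rfl)
  have he₄ := he₃.trans (reach_of_operate (r := aux e₄) rfl)
  have hz₀ := (reach_pad_of_e₀ (K := K) (p := p) (Fin.last p)).trans (reach_z₀_of_pad _)
  have hz₁ := hz₀.trans (reach_of_operate (r := aux z₁) rfl)
  have hz₂ := hz₁.trans (reach_of_operate (r := aux z₂) rfl)
  have hz₃ := hz₂.trans (reach_of_operate (r := aux z₃) rfl)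
  have ho₀ := hz₃.trans (reach_of_rotate (r := aux o₀) rfl)
  have ho₁ := ho₀.trans (reach_of_operate (r := aux o₁) rfl)
  have ho₂ := ho₁.trans (reach_of_operate (r := aux o₂) rfl)
  have ho₃ := ho₂.trans (reach_of_operate (r := aux o₃) rfl)
  have hd₀ := (reach_ring_of_e₀ (p := p) (0 : Fin (K + 1)) 0).trans (reach_enter 0)
  have hd₁ := (reach_ring_of_e₀ (p := p) (0 : Fin (K + 1)) 1).trans (reach_enter 1)
  have hd₂ := (reach_ring_of_e₀ (p := p) (0 : Fin (K + 1)) 2).trans (reach_enter 2)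
  have hd₃ := hd₂.trans (reach_of_operate (r := aux d₃) rfl)
  rintro (_ | _ | _ | _ | _ | _ | _ | _ | _ | _ | _ | _ | _ | _ | _ | _ | _)
  all_goals first | exact .refl | assumption

theorem reach_of_e₀ : ∀ q : State K p, Reach (aux e₀) q
  | aux s => reach_aux_of_e₀ s
  | pad i => reach_pad_of_e₀ i
  | ring i v => reach_ring_of_e₀ i v

theorem exists_evalWord (q r : State K p) : ∃ w, evalWord step q w = some r :=
  exists_evalWord_of_reflTransGen ((reach_e₀ q).trans (reach_of_e₀ r))

/-! ### The automaton on `Fin n` -/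

theorem exists_pfa {n : ℕ} (hK : 0 < K) (hn : 3 * K + 21 + p = n) :
    ∃ (δ : Fin n → Fin 2 → Option (Fin n)) (S : Finset (Fin n)),
      pfaTransitive δ ∧ (∃ w, pfaSync δ S w) ∧ ∀ w, pfaSync δ S w → 3 ^ K ≤ w.length := by
  classical
  let e : State K p ≃ Fin n := Fintype.equivFinOfCardEq (card_state.trans hn)
  let T : Finset (State K p) :=
    insert (aux z₀) (Finset.univ.image fun i : Fin K => ring i.castSucc 0)
  have hS : (T.map e.toEmbedding).Nonempty := ⟨e (aux z₀), by simp [T]⟩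
  have hmerge : ∀ w r, (∀ q ∈ T.map e.toEmbedding,
      evalWord (fun s a => (step (e.symm s) a).map e) q w = some (e r)) ↔
      Merges w r (0 : Fin K → Fin 3) 0 false := fun w r => by
    simp only [T, Finset.forall_mem_map, Equiv.coe_toEmbedding, evalWord_conj,
      Finset.forall_mem_insert, Finset.forall_mem_image, Option.map_eq_some_iff,
      EmbeddingLike.apply_eq_iff_eq, exists_eq_right, Finset.mem_univ, Merges,
      control, cond_false, sub_zero, Pi.zero_apply, forall_const]
  refine ⟨fun s a => (step (e.symm s) a).map e, T.map e.toEmbedding, fun q q' => ?_, ?_, ?_⟩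
  · obtain ⟨w, hw⟩ := exists_evalWord (e.symm q) (e.symm q')
    refine ⟨w, pfaRun_eq_singleton (Finset.singleton_nonempty q) fun s hs => ?_⟩
    rw [Finset.mem_singleton.1 hs, ← e.apply_symm_apply q, evalWord_conj, hw, Option.map_some,
      e.apply_symm_apply]
  · obtain ⟨w, hw⟩ := exists_merges (p := p) (0 : Fin K → Fin 3) 0 false
      (by simp [potential, value])
    exact ⟨w, (pfaSync_iff hS).2 ⟨e (aux e₀), (hmerge w _).2 hw⟩⟩
  · intro w hw
    obtain ⟨r, hr⟩ := (pfaSync_iff hS).1 hw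
    have hm := (hmerge w (e.symm r)).1 (by simpa only [e.apply_symm_apply] using hr)
    have := pow_le_of_merges hK hm
    simpa [potential, value] using this

end TernaryCounter

theorem stmt11 (ε : ℝ) (hε0 : 0 < ε) (hε1 : ε < 1) :
    ∃ c : ℝ, 0 < c ∧ ∃ n₀ : ℕ, ∀ n : ℕ, n₀ ≤ n →
      ∃ (δ : Fin n → Fin 2 → Option (Fin n)) (S : Finset (Fin n)),
        pfaTransitive δ ∧
        (∃ w, pfaSync δ S w) ∧
        (∀ w, pfaSync δ S w →
          c * (3 - ε) ^ ((n : ℝ) / 3) ≤ (w.length : ℝ)) := by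
  refine ⟨3 ^ (-8 : ℝ), by positivity, 24, fun n hn => ?_⟩
  obtain ⟨K, p, hK, hp, hKp⟩ : ∃ K p, 0 < K ∧ p < 3 ∧ 3 * K + 21 + p = n :=
    ⟨(n - 21) / 3, (n - 21) % 3, by omega, by omega, by omega⟩
  obtain ⟨δ, S, hδ, hsync, hlen⟩ := TernaryCounter.exists_pfa (p := p) hK hKp
  refine ⟨δ, S, hδ, hsync, fun w hw => ?_⟩
  have hn3 : (n : ℝ) / 3 ≤ K + 8 := by
    have : (n : ℝ) ≤ 3 * K + 24 := by exact_mod_cast (by omega : n ≤ 3 * K + 24)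
    linarith
  calc (3 : ℝ) ^ (-8 : ℝ) * (3 - ε) ^ ((n : ℝ) / 3)
      ≤ 3 ^ (-8 : ℝ) * 3 ^ ((n : ℝ) / 3) := by
        gcongr
        · linarith
        · linarith
    _ ≤ 3 ^ (-8 : ℝ) * 3 ^ ((K : ℝ) + 8) := by
        gcongr
        norm_num
    _ = (3 : ℝ) ^ K := by
        rw [← Real.rpow_add (by norm_num), ← Real.rpow_natCast]
        congr 1
        ring
    _ ≤ w.length := by exact_mod_cast hlen w hw
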